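/- arXiv:2403.06882 — 2 statements merged into one kernel-verified Lean document; each statement's English description precedes it below -/
import Mathlib

section
/- Let η ≠ 0, let w̄ and ξ̄ be m-tuples of complex numbers, and let C₁, C₂ : ℂ → ℂ be arbitrary functions. Assume: the entries of w̄ are pairwise distinct with w_a − w_b ∉ {η, −η} for a ≠ b, the entries of ξ̄ are pairwise distinct, and w_a − ξ_b ∉ {0, η, −η} for all a, b. Then Σ_{w̄ ↦ {w̄₁,w̄₂}} K_m((w̄₁−η)∪w̄₂ | ξ̄) · f(ξ̄,w̄₁) f(w̄₁,w̄₂) C₁(w̄₁) C₂(w̄₂) = Δ'(ξ̄) Δ(w̄) · det_m[ C₂(w_k) t(w_k,ξ_j) h(w_k,ξ̄) + (−1)^m C₁(w_k) (f(w_k,w̄_k)/f(w̄_k,w_k)) t(ξ_j,w_k) h(ξ̄,w_k) ]_{j,k=1}^{m}, where the sum is over all 2^m partitions of the entries of w̄ into disjoint subsets w̄₁ and w̄₂, w̄_k denotes w̄ with the entry w_k removed, w̄₁−η denotes the tuple obtained by subtracting η from each entry of w̄₁, and C_i(w̄) denotes Π C_i(w_a) over the entries. -/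
open Finset

noncomputable section


/-- `g(u,v) = η/(u−v)` -/
def gg (η u v : ℂ) : ℂ := η / (u - v)

/-- `f(u,v) = (u−v+η)/(u−v)` -/
def ff (η u v : ℂ) : ℂ := (u - v + η) / (u - v)

/-- `h(u,v) = (u−v+η)/η` -/
def hh (η u v : ℂ) : ℂ := (u - v + η) / η

/-- `t(u,v) = η²/((u−v)(u−v+η))` -/
def tt (η u v : ℂ) : ℂ := η ^ 2 / ((u - v) * (u - v + η))

/-- `Δ(w̄) = Π_{j<k} g(w_k,w_j)` -/
def Delta (η : ℂ) {n : ℕ} (w : Fin n → ℂ) : ℂ :=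
  ∏ j : Fin n, ∏ k ∈ Finset.univ.filter (fun k => j < k), gg η (w k) (w j)

/-- `Δ'(w̄) = Π_{j<k} g(w_j,w_k)` -/
def Delta' (η : ℂ) {n : ℕ} (w : Fin n → ℂ) : ℂ :=
  ∏ j : Fin n, ∏ k ∈ Finset.univ.filter (fun k => j < k), gg η (w j) (w k)

/-- The highest coefficient `K_N(v̄|ū)`. -/
def Kc (η : ℂ) (N : ℕ) (v u : Fin N → ℂ) : ℂ :=
  Delta' η v * Delta η u * (∏ j, ∏ k, hh η (v j) (u k)) *
    Matrix.det (Matrix.of fun j k : Fin N => tt η (v j) (u k))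

/-- The `m`-tuple of values of `w` on the finset `S`, listed in increasing index order
(meaningful when `S.card = m`). -/
def subT {n : ℕ} (w : Fin n → ℂ) (S : Finset (Fin n)) (m : ℕ) : Fin m → ℂ :=
  fun i => ((S.sort (· ≤ ·)).map w).getD i 0

theorem gg_swap (η u v : ℂ) : gg η u v = -gg η v u := by
  rw [gg, gg, ← neg_sub v u, div_neg]

theorem tt_swap_eq (η u v : ℂ) : tt η u v = tt η (v - η) u := by
  unfold tt
  congr 1
  ring

/-- Shifting the first argument of `h` by `-η` and multiplying by `f` flips the arguments of `h`. -/
theorem hh_sub_mul_ff {η u v : ℂ} (huv : u - v ≠ 0) :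
    hh η (u - η) v * ff η v u = -hh η v u := by
  have hvu : v - u ≠ 0 := by rwa [← neg_sub, neg_ne_zero]
  unfold hh ff
  rw [div_mul_div_comm, sub_right_comm, sub_add_cancel, ← neg_sub v u, neg_mul, neg_div,
    mul_comm η, mul_div_mul_left _ _ hvu]

/-- A product over ordered pairs of distinct indices, grouped by unordered pairs. -/
theorem prod_erase_eq_prod_lt {n : ℕ} (F : Fin n → Fin n → ℂ) :
    ∏ i, ∏ j ∈ univ.erase i, F i j =
      ∏ i, ∏ j ∈ univ.filter (fun j => i < j), F i j * F j i := by
  have h := prod_prod_Ioi_mul_eq_prod_prod_off_diag (fun j i => F i j)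
  simp only [compl_singleton] at h
  rw [← h]
  refine prod_congr rfl fun i _ => prod_congr (by ext; simp) fun j _ => rfl

theorem prod_prod_compl_eq_prod_lt {n : ℕ} (S : Finset (Fin n)) (F : Fin n → Fin n → ℂ) :
    ∏ a ∈ S, ∏ b ∈ Sᶜ, F a b =
      ∏ i, ∏ j ∈ univ.filter (fun j => i < j),
        (if i ∈ S ∧ j ∉ S then F i j else 1) * (if j ∈ S ∧ i ∉ S then F j i else 1) := by
  rw [← prod_erase_eq_prod_lt (fun i j => if i ∈ S ∧ j ∉ S then F i j else 1),
    ← prod_subset (subset_univ S) fun i _ hi => by simp [hi]]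
  refine prod_congr rfl fun a ha => ?_
  have hsub : Sᶜ ⊆ univ.erase a := fun b hb =>
    mem_erase.mpr ⟨fun h => mem_compl.mp hb (h ▸ ha), mem_univ b⟩
  rw [← prod_subset hsub fun b _ hb => by simp [not_not.mp (mt mem_compl.mpr hb)]]
  exact prod_congr rfl fun b hb => by simp [ha, mem_compl.mp hb]

/-- The effect on `Δ'` of shifting the entries indexed by `S` by `-η`. -/
theorem Delta'_shift {η : ℂ} {n : ℕ} {w : Fin n → ℂ} (ξ : Fin n → ℂ) (S : Finset (Fin n))
    (hw : Function.Injective w) (hwη : ∀ a b, a ≠ b → w a - w b ≠ η ∧ w a - w b ≠ -η) :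
    Delta' η (fun i => if i ∈ S then w i - η else w i) * Delta η ξ *
        (∏ a ∈ S, ∏ b ∈ Sᶜ, ff η (w a) (w b)) =
      Delta' η ξ * Delta η w *
        ∏ k ∈ S, ((∏ a ∈ univ.erase k, ff η (w k) (w a)) /
          (∏ a ∈ univ.erase k, ff η (w a) (w k))) := by
  have hR : ∏ k ∈ S, ((∏ a ∈ univ.erase k, ff η (w k) (w a)) /
          (∏ a ∈ univ.erase k, ff η (w a) (w k))) =
      ∏ i, ∏ j ∈ univ.erase i, if i ∈ S then ff η (w i) (w j) / ff η (w j) (w i) else 1 := by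
    rw [← prod_subset (subset_univ S) fun i _ hi => by simp [hi]]
    exact prod_congr rfl fun k hk => by simp [hk, prod_div_distrib]
  rw [hR, prod_erase_eq_prod_lt, prod_prod_compl_eq_prod_lt]
  simp only [Delta, Delta', ← prod_mul_distrib]
  refine prod_congr rfl fun j _ => prod_congr rfl fun k hk => ?_
  have hjk : j ≠ k := (mem_filter.mp hk).2.ne
  have h1 : w j - w k ≠ 0 := sub_ne_zero.mpr (hw.ne hjk)
  have h2 : w k - w j ≠ 0 := sub_ne_zero.mpr (hw.ne hjk.symm)
  have h3 : w j - w k + η ≠ 0 := fun h => (hwη j k hjk).2 (eq_neg_of_add_eq_zero_left h)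
  have h4 : w k - w j + η ≠ 0 := fun h => (hwη k j hjk.symm).2 (eq_neg_of_add_eq_zero_left h)
  have h5 : w j - η - w k ≠ 0 := fun h => h4 (by linear_combination -h)
  have h6 : w j - (w k - η) ≠ 0 := fun h => h3 (by linear_combination h)
  rw [gg_swap η (ξ k) (ξ j)]
  by_cases hj : j ∈ S <;> by_cases hk' : k ∈ S <;>
    simp only [hj, hk', if_true, if_false, and_true, and_false, not_true, not_false_iff,
      mul_one, one_mul, gg_swap η (w k) (w j)]
  · rw [div_mul_div_comm, mul_comm (ff η (w k) (w j)), div_self, gg, sub_sub_sub_cancel_right, ← gg]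
    · ring
    · exact mul_ne_zero (div_ne_zero h3 h1) (div_ne_zero h4 h2)
  · have : gg η (w j - η) (w k) * ff η (w k) (w j) = gg η (w j) (w k) := by
      unfold gg ff; field_simp; ring
    rw [← this]
    have : ff η (w k) (w j) ≠ 0 := div_ne_zero h4 h2
    field_simp
  · have : gg η (w j) (w k - η) * ff η (w j) (w k) = gg η (w j) (w k) := by
      unfold gg ff; field_simp; ring
    rw [← this]
    have : ff η (w j) (w k) ≠ 0 := div_ne_zero h3 h1
    field_simp
  · ring

/-- corollary of Lemma 2, with the ratio factor `f(w_k,w̄_k)/f(w̄_k,w_k)`. -/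
theorem stmt4 (η : ℂ) (hη : η ≠ 0) (m : ℕ) (w ξ : Fin m → ℂ) (C₁ C₂ : ℂ → ℂ)
    (hw : Function.Injective w)
    (hwη : ∀ a b, a ≠ b → w a - w b ≠ η ∧ w a - w b ≠ -η)
    (hξ : Function.Injective ξ)
    (hwξ : ∀ a b, w a - ξ b ≠ 0 ∧ w a - ξ b ≠ η ∧ w a - ξ b ≠ -η) :
    ∑ S : Finset (Fin m),
      Kc η m (fun i => if i ∈ S then w i - η else w i) ξ *
        (∏ j, ∏ a ∈ S, ff η (ξ j) (w a)) * (∏ a ∈ S, ∏ b ∈ Sᶜ, ff η (w a) (w b)) *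
        (∏ a ∈ S, C₁ (w a)) * (∏ a ∈ Sᶜ, C₂ (w a))
    = Delta' η ξ * Delta η w *
        Matrix.det (Matrix.of fun j k : Fin m =>
          C₂ (w k) * tt η (w k) (ξ j) * (∏ a, hh η (w k) (ξ a)) +
            (-1) ^ m * C₁ (w k) *
              ((∏ a ∈ Finset.univ.erase k, ff η (w k) (w a)) /
                (∏ a ∈ Finset.univ.erase k, ff η (w a) (w k))) *
              tt η (ξ j) (w k) * (∏ a, hh η (ξ a) (w k))) := by
  have hdet : ∀ c₁ c₂ : Fin m → ℂ,
      Matrix.det (Matrix.of fun j k : Fin m => c₂ k * tt η (w k) (ξ j) + c₁ k * tt η (ξ j) (w k)) =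
        ∑ S : Finset (Fin m), (∏ a ∈ S, c₁ a) * (∏ a ∈ Sᶜ, c₂ a) *
          Matrix.det (Matrix.of fun j k : Fin m =>
            tt η (if j ∈ S then w j - η else w j) (ξ k)) := by
    intro c₁ c₂
    rw [← Matrix.det_transpose]
    have h := (Matrix.detRowAlternating (n := Fin m) (R := ℂ)).toMultilinearMap.map_add_univ
      (fun k j => c₁ k * tt η (ξ j) (w k)) (fun k j => c₂ k * tt η (w k) (ξ j))
    refine Eq.trans (congrArg Matrix.det ?_) (h.trans (sum_congr rfl fun S _ => ?_))
    · ext k j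
      exact add_comm _ _
    · have hprod : (∏ a ∈ S, c₁ a) * (∏ a ∈ Sᶜ, c₂ a) = ∏ k, S.piecewise c₁ c₂ k := by
        rw [prod_piecewise, univ_inter, compl_eq_univ_sdiff]
      rw [hprod, ← Matrix.det_mul_column]
      refine congrArg Matrix.det ?_
      ext k j
      by_cases hk : k ∈ S <;> simp [hk, tt_swap_eq η (ξ j)]
  have hcoef := hdet
    (fun k => (-1) ^ m * C₁ (w k) * ((∏ a ∈ univ.erase k, ff η (w k) (w a)) /
      (∏ a ∈ univ.erase k, ff η (w a) (w k))) * ∏ a, hh η (ξ a) (w k))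
    (fun k => C₂ (w k) * ∏ a, hh η (w k) (ξ a))
  simp only [mul_right_comm _ (tt η _ _)]
  rw [hcoef, mul_sum]
  refine sum_congr rfl fun S _ => ?_
  have hh_split : (∏ j, ∏ k, hh η (if j ∈ S then w j - η else w j) (ξ k)) *
      (∏ j, ∏ a ∈ S, ff η (ξ j) (w a)) =
      (∏ a ∈ S, (-1) ^ m * ∏ j, hh η (ξ j) (w a)) * ∏ a ∈ Sᶜ, ∏ j, hh η (w a) (ξ j) := by
    rw [prod_comm (s := univ) (t := S), ← prod_mul_prod_compl S, mul_right_comm,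
      ← prod_mul_distrib]
    congr 1
    · refine prod_congr rfl fun a ha => ?_
      simp only [ha, if_true, ← prod_mul_distrib, hh_sub_mul_ff (hwξ a _).1]
      rw [prod_neg, card_univ, Fintype.card_fin]
    · exact prod_congr rfl fun a ha => by simp [mem_compl.mp ha]
  have hΔ := Delta'_shift ξ S hw hwη
  unfold Kc
  simp only [prod_mul_distrib] at hh_split ⊢
  linear_combination
    (∏ a ∈ S, C₁ (w a)) * (∏ a ∈ Sᶜ, C₂ (w a)) *
      Matrix.det (Matrix.of fun j k : Fin m => tt η (if j ∈ S then w j - η else w j) (ξ k)) *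
      ((Delta' η (fun i => if i ∈ S then w i - η else w i) * Delta η ξ *
        (∏ a ∈ S, ∏ b ∈ Sᶜ, ff η (w a) (w b))) * hh_split +
      ((∏ a ∈ S, (-1) ^ m) * (∏ a ∈ S, ∏ j, hh η (ξ j) (w a)) *
        ∏ a ∈ Sᶜ, ∏ j, hh η (w a) (ξ j)) * hΔ)
end
end

section
/- Let η ≠ 0, β ∈ ℂ, N ≥ 1, and let v̄ = (v_1,…,v_N), ū = (u_1,…,u_N) be tuples of complex numbers such that: the u_j are pairwise distinct, the v_j are pairwise distinct, u_k ≠ v_j for all j, k, u_a − u_b ∉ {η, −η} and v_a − v_b ∉ {η, −η} for a ≠ b, and u_k − v_j ∉ {η, −η} for all j, k. Define 𝔽_N(v̄,ū|β) = Δ'(v̄) Δ(ū) h(ū,v̄) · det_N[ e^β t(u_k,v_j) + t(v_j,u_k) · h(u_k,ū) h(v̄,u_k) / (h(ū,u_k) h(u_k,v̄)) ]_{j,k=1}^{N}. Then the symmetry relation 𝔽_N(v̄,ū|β) = e^{βN} · 𝔽_N(ū,v̄|−β) holds. -/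
open Finset

noncomputable section


/-- The scalar-product function `𝔽_N(v̄,ū|β)`. -/
def FJ (η β : ℂ) (n : ℕ) (v u : Fin n → ℂ) : ℂ :=
  Delta' η v * Delta η u * (∏ a, ∏ b, hh η (u a) (v b)) *
    Matrix.det (Matrix.of fun j k : Fin n =>
      Complex.exp β * tt η (u k) (v j) +
        tt η (v j) (u k) * ((∏ a, hh η (u k) (u a)) * ∏ a, hh η (v a) (u k)) /
          ((∏ a, hh η (u a) (u k)) * ∏ a, hh η (u k) (v a)))

/-- The function `z f(x,V̄) f(Ū,x) − f(V̄,x) f(x,Ū)`, the coefficient of the reduction of the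
scalar-product function in its size. -/
def residueCoeff (η z x : ℂ) {n m : ℕ} (V : Fin n → ℂ) (U : Fin m → ℂ) : ℂ :=
  z * ((∏ i, ff η x (V i)) * ∏ i, ff η (U i) x) -
    (∏ i, ff η (V i) x) * ∏ i, ff η x (U i)

/-- The scalar-product function with the exponential of the twist as a free parameter `z`. -/
def twistedFJ (η z : ℂ) (n : ℕ) (v u : Fin n → ℂ) : ℂ :=
  Delta' η v * Delta η u * (∏ a, ∏ b, hh η (u a) (v b)) *
    Matrix.det (Matrix.of fun j k : Fin n =>
      z * tt η (u k) (v j) +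
        tt η (v j) (u k) * ((∏ a, hh η (u k) (u a)) * ∏ a, hh η (v a) (u k)) /
          ((∏ a, hh η (u a) (u k)) * ∏ a, hh η (u k) (v a)))

/-- The genericity assumptions on a pair of tuples. -/
structure GenericPair (η : ℂ) {n : ℕ} (v u : Fin n → ℂ) : Prop where
  injU : Function.Injective u
  injV : Function.Injective v
  ne : ∀ j k, u k ≠ v j
  shiftU : ∀ a b, a ≠ b → u a - u b ≠ -η
  shiftV : ∀ a b, a ≠ b → v a - v b ≠ -η
  shiftUV : ∀ j k, u k - v j ≠ -η
  shiftVU : ∀ j k, v j - u k ≠ -η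

theorem GenericPair.swap {η : ℂ} {n : ℕ} {v u : Fin n → ℂ} (h : GenericPair η v u) :
    GenericPair η u v :=
  ⟨h.injV, h.injU, fun j k => (h.ne k j).symm, h.shiftV, h.shiftU,
    fun j k => h.shiftVU k j, fun j k => h.shiftUV k j⟩

theorem GenericPair.comp {η : ℂ} {n m : ℕ} {v u : Fin n → ℂ} (h : GenericPair η v u)
    {p q : Fin m → Fin n} (hp : Function.Injective p) (hq : Function.Injective q) :
    GenericPair η (v ∘ p) (u ∘ q) :=
  ⟨h.injU.comp hq, h.injV.comp hp, fun j k => h.ne (p j) (q k),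
    fun _ _ hab => h.shiftU _ _ (hq.ne hab), fun _ _ hab => h.shiftV _ _ (hp.ne hab),
    fun _ _ => h.shiftUV _ _, fun _ _ => h.shiftVU _ _⟩

theorem GenericPair.removeNth {η : ℂ} {n : ℕ} {v u : Fin (n + 1) → ℂ} (h : GenericPair η v u)
    (j k : Fin (n + 1)) : GenericPair η (v ∘ j.succAbove) (u ∘ k.succAbove) :=
  h.comp Fin.succAbove_right_injective Fin.succAbove_right_injective

/-- Partial fraction expansion of `∏ (s - x_i + e_i)/(s - x_i)`. -/
theorem prod_shift_div_eq_one_add_sum {ι : Type*} [DecidableEq ι] (x e : ι → ℂ) (S : Finset ι)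
    (hx : Set.InjOn x S) (s : ℂ) (hs : ∀ i ∈ S, s ≠ x i) :
    ∏ i ∈ S, (s - x i + e i) / (s - x i) =
      1 + ∑ i ∈ S, e i / (s - x i) * ∏ l ∈ S.erase i, (x i - x l + e l) / (x i - x l) := by
  induction S using Finset.induction_on generalizing s with
  | empty => simp
  | insert a S ha ih =>
    have hxS : Set.InjOn x S := hx.mono (by simp)
    have hne : ∀ i ∈ S, x a ≠ x i := fun i hi h => by
      have := hx (by simp) (by simp [hi]) h
      exact ha (this ▸ hi)
    have hsS : ∀ i ∈ S, s ≠ x i := fun i hi => hs i (by simp [hi])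
    have hsa : s - x a ≠ 0 := sub_ne_zero.2 (hs a (by simp))
    have h1 := ih hxS s hsS
    have h2 := ih hxS (x a) hne
    rw [Finset.prod_insert ha, Finset.sum_insert ha, Finset.erase_insert ha, h1, h2]
    have key : ∀ i ∈ S, e i / (s - x i) *
        ∏ l ∈ (insert a S).erase i, (x i - x l + e l) / (x i - x l) =
        (s - x a + e a) / (s - x a) *
          (e i / (s - x i) * ∏ l ∈ S.erase i, (x i - x l + e l) / (x i - x l)) -
        e a / (s - x a) *
          (e i / (x a - x i) * ∏ l ∈ S.erase i, (x i - x l + e l) / (x i - x l)) := by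
      intro i hi
      have hia : a ≠ i := fun h => ha (h ▸ hi)
      rw [Finset.erase_insert_of_ne hia, Finset.prod_insert (by simp [ha])]
      have h3 : s - x i ≠ 0 := sub_ne_zero.2 (hsS i hi)
      have h4 : x a - x i ≠ 0 := sub_ne_zero.2 (hne i hi)
      have h5 : x i - x a ≠ 0 := sub_ne_zero.2 (hne i hi).symm
      generalize ∏ l ∈ S.erase i, (x i - x l + e l) / (x i - x l) = R
      rw [show x i - x a = -(x a - x i) by ring]
      field_simp
      ring
    rw [Finset.sum_congr rfl key, Finset.sum_sub_distrib, ← Finset.mul_sum, ← Finset.mul_sum]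
    field_simp
    ring

theorem prod_filter_lt_succAbove {n : ℕ} (G : Fin (n + 1) → Fin (n + 1) → ℂ)
    (hG : ∀ a b, G a b = -G b a) (j : Fin (n + 1)) :
    ∏ a, ∏ b ∈ Finset.univ.filter (fun b => a < b), G a b =
      (-1) ^ (j : ℕ) * (∏ i, G j (j.succAbove i)) *
        ∏ a, ∏ b ∈ Finset.univ.filter (fun b => a < b), G (j.succAbove a) (j.succAbove b) := by
  simp only [Finset.prod_filter]
  rw [Fin.prod_univ_succAbove _ j]
  simp only [Fin.prod_univ_succAbove _ j, lt_irrefl, if_false, one_mul,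
    Fin.succAbove_lt_succAbove_iff, Finset.prod_mul_distrib]
  rw [← mul_assoc, ← Finset.prod_mul_distrib]
  congr 1
  have hsign : ((-1 : ℂ)) ^ (j : ℕ) = ∏ i : Fin n, if j.succAbove i < j then (-1 : ℂ) else 1 := by
    rw [← Finset.prod_filter, Finset.prod_const]
    congr 1
    simp only [Fin.succAbove_lt_iff_castSucc_lt]
    have : Finset.univ.filter (fun i : Fin n => i.castSucc < j) =
        Finset.univ.filter (fun i : Fin n => (i : ℕ) < j) := by
      ext i; simp [Fin.lt_def]
    rw [this, Fin.card_filter_val_lt]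
    have := j.2
    omega
  rw [hsign, ← Finset.prod_mul_distrib]
  refine Finset.prod_congr rfl fun i _ => ?_
  rcases lt_or_gt_of_ne (Fin.succAbove_ne j i) with h | h
  · simp [h, h.not_gt, hG (j.succAbove i) j]
  · simp [h, h.not_gt]

theorem gg_antisymm (η a b : ℂ) : gg η a b = -gg η b a := by
  unfold gg
  rw [← neg_sub b a, div_neg]

theorem Delta'_eq_mul_succAbove (η : ℂ) {n : ℕ} (w : Fin (n + 1) → ℂ) (j : Fin (n + 1)) :
    Delta' η w = (-1) ^ (j : ℕ) * (∏ i, gg η (w j) (w (j.succAbove i))) *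
      Delta' η (w ∘ j.succAbove) :=
  prod_filter_lt_succAbove (fun a b => gg η (w a) (w b)) (fun _ _ => gg_antisymm _ _ _) j

theorem Delta_eq_mul_succAbove (η : ℂ) {n : ℕ} (w : Fin (n + 1) → ℂ) (j : Fin (n + 1)) :
    Delta η w = (-1) ^ (j : ℕ) * (∏ i, gg η (w (j.succAbove i)) (w j)) *
      Delta η (w ∘ j.succAbove) :=
  prod_filter_lt_succAbove (fun a b => gg η (w b) (w a)) (fun _ _ => gg_antisymm _ _ _) j

theorem prod_erase_eq_prod_ite {ι : Type*} [Fintype ι] [DecidableEq ι] (a : ι) (F : ι → ℂ) :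
    ∏ l ∈ Finset.univ.erase a, F l = ∏ l, if l = a then 1 else F l := by
  rw [← Finset.mul_prod_erase Finset.univ (fun l => if l = a then 1 else F l)
    (Finset.mem_univ a), if_pos rfl, one_mul]
  exact Finset.prod_congr rfl fun l hl => by rw [if_neg (Finset.ne_of_mem_erase hl)]

/-- Lagrange interpolation at `n + 1` nodes, one of which is singled out. -/
theorem eval_div_sub_eq_interpolation {n : ℕ} (x : Fin n → ℂ) (hx : Function.Injective x)
    (s t : ℂ) (hst : t ≠ s) (hs : ∀ i, s ≠ x i) (ht : ∀ i, t ≠ x i)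
    (Q : Polynomial ℂ) (hQ : Q.natDegree ≤ n) :
    Q.eval s / (t - s) =
      (∏ i, (s - x i)) * (Q.eval t / ((t - s) * ∏ i, (t - x i))) +
      ∑ i, Q.eval (x i) / (t - x i) *
        ((∏ l, (s - x l)) * (Lagrange.nodalWeight Finset.univ x i * (s - x i)⁻¹)) := by
  have hinj : Set.InjOn (Fin.cons t x : Fin (n + 1) → ℂ)
      (Finset.univ : Finset (Fin (n + 1))) := by
    refine Function.Injective.injOn (Fin.cons_injective_iff.2 ⟨?_, hx⟩)
    rintro ⟨i, hi⟩
    exact ht i hi.symm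
  have hdeg : Q.degree < (Finset.univ : Finset (Fin (n + 1))).card := by
    refine lt_of_le_of_lt Polynomial.degree_le_natDegree ?_
    simp only [Finset.card_univ, Fintype.card_fin]
    exact_mod_cast Nat.lt_succ_of_le hQ
  have hnode : ∀ i ∈ (Finset.univ : Finset (Fin (n + 1))),
      s ≠ (Fin.cons t x : Fin (n + 1) → ℂ) i := by
    intro i _
    refine Fin.cases ?_ (fun i => ?_) i
    · simpa using hst.symm
    · simpa using hs i
  have h := congrArg (Polynomial.eval s) (Lagrange.eq_interpolate hinj hdeg)
  rw [Lagrange.eval_interpolate_not_at_node _ hnode, Lagrange.eval_nodal,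
    Fin.prod_univ_succ, Fin.sum_univ_succ] at h
  have hts : t - s ≠ 0 := sub_ne_zero.2 hst
  have hst' : s - t ≠ 0 := sub_ne_zero.2 hst.symm
  have hw0 : Lagrange.nodalWeight Finset.univ (Fin.cons t x : Fin (n + 1) → ℂ) 0 =
      (∏ i, (t - x i))⁻¹ := by
    rw [Lagrange.nodalWeight, prod_erase_eq_prod_ite, Fin.prod_univ_succ]
    simp [Finset.prod_inv_distrib]
  have hw : ∀ i : Fin n,
      Lagrange.nodalWeight Finset.univ (Fin.cons t x : Fin (n + 1) → ℂ) i.succ =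
        (x i - t)⁻¹ * Lagrange.nodalWeight Finset.univ x i := by
    intro i
    rw [Lagrange.nodalWeight, Lagrange.nodalWeight, prod_erase_eq_prod_ite,
      prod_erase_eq_prod_ite, Fin.prod_univ_succ]
    simp [(Fin.succ_ne_zero i).symm]
  simp only [hw0, hw, Fin.cons_zero, Fin.cons_succ] at h
  rw [h, mul_add, add_div]
  congr 1
  · field_simp
  · rw [Finset.mul_sum, Finset.sum_div]
    refine Finset.sum_congr rfl fun i _ => ?_
    have h1 : t - x i ≠ 0 := sub_ne_zero.2 (ht i)
    rw [show x i - t = -(t - x i) by ring, show s - t = -(t - s) by ring]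
    field_simp

theorem sum_eval_div_sub_eq {n m : ℕ} (x : Fin n → ℂ) (hx : Function.Injective x)
    (u : Fin m → ℂ) (s : ℂ) (hsu : ∀ k, u k ≠ s) (hs : ∀ i, s ≠ x i)
    (hux : ∀ k i, u k ≠ x i) (Q : Fin m → Polynomial ℂ) (hQ : ∀ k, (Q k).natDegree ≤ n)
    (hzero : ∀ i, ∑ k, (Q k).eval (x i) / (u k - x i) = 0) :
    ∑ k, (Q k).eval s / (u k - s) =
      (∏ i, (s - x i)) * ∑ k, (Q k).eval (u k) / ((u k - s) * ∏ i, (u k - x i)) := by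
  rw [Finset.sum_congr rfl fun k _ => eval_div_sub_eq_interpolation x hx s (u k) (hsu k) hs
    (hux k) (Q k) (hQ k), Finset.sum_add_distrib, Finset.sum_comm, ← Finset.mul_sum]
  simp [← Finset.sum_mul, hzero]

/-- The matrix of the scalar-product function with its column denominators cleared. -/
def clearedMatrix (η z : ℂ) {n : ℕ} (v u : Fin n → ℂ) : Matrix (Fin n) (Fin n) ℂ :=
  Matrix.of fun j k =>
    z * tt η (u k) (v j) * (∏ b, hh η (u k) (v b)) +
      tt η (v j) (u k) * (∏ b, hh η (v b) (u k)) * ∏ a, hh η (u k) (u a) / hh η (u a) (u k)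

theorem hh_ne_zero {η a b : ℂ} (hη : η ≠ 0) (h : a - b ≠ -η) : hh η a b ≠ 0 :=
  div_ne_zero (fun h0 => h (eq_neg_of_add_eq_zero_left h0)) hη

theorem tt_mul_hh {η a b : ℂ} (hη : η ≠ 0) (h : a - b ≠ -η) :
    tt η a b * hh η a b = gg η a b := by
  have h1 : a - b + η ≠ 0 := fun h0 => h (eq_neg_of_add_eq_zero_left h0)
  unfold tt hh gg
  by_cases h2 : a - b = 0
  · simp [h2]
  · field_simp

theorem twistedFJ_eq_det_clearedMatrix {η : ℂ} (hη : η ≠ 0) (z : ℂ) {n : ℕ} {v u : Fin n → ℂ}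
    (h : GenericPair η v u) :
    twistedFJ η z n v u = Delta' η v * Delta η u * (clearedMatrix η z v u).det := by
  rw [twistedFJ, mul_assoc, ← Matrix.det_mul_row]
  congr 2
  ext j k
  have h1 : ∏ b, hh η (u k) (v b) ≠ 0 :=
    Finset.prod_ne_zero_iff.2 fun b _ => hh_ne_zero hη (h.shiftUV b k)
  simp only [clearedMatrix, Matrix.of_apply, Finset.prod_div_distrib]
  by_cases h2 : ∏ a, hh η (u a) (u k) = 0
  · simp [h2]; ring
  · field_simp

/-- The rows of the cleared matrix other than the one singled out, as functions of the variable
`s` attached to the latter. -/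
def clearedRow (η z : ℂ) {n m : ℕ} (x : Fin n → ℂ) (u : Fin m → ℂ) (s : ℂ) (i : Fin n)
    (l : Fin m) : ℂ :=
  z * tt η (u l) (x i) * (∏ b, hh η (u l) (x b)) * hh η (u l) s +
    tt η (x i) (u l) * (∏ b, hh η (x b) (u l)) * (∏ a, hh η (u l) (u a) / hh η (u a) (u l)) *
      hh η s (u l)

/-- The numerator of the entries in the row singled out. -/
def rowWeight (η z : ℂ) {n m : ℕ} (x : Fin n → ℂ) (u : Fin m → ℂ) (l : Fin m) : ℂ :=
  z * (∏ b, hh η (u l) (x b)) -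
    (∏ b, hh η (x b) (u l)) * ∏ a, hh η (u l) (u a) / hh η (u a) (u l)

theorem clearedMatrix_apply_self {η : ℂ} (hη : η ≠ 0) (z : ℂ) {n : ℕ} {v u : Fin (n + 1) → ℂ}
    (h : GenericPair η v u) (j l : Fin (n + 1)) :
    clearedMatrix η z v u j l =
      rowWeight η z (v ∘ j.succAbove) u l * gg η (u l) (v j) := by
  have h1 := tt_mul_hh hη (h.shiftUV j l)
  have h2 := tt_mul_hh hη (h.shiftVU j l)
  rw [gg_antisymm] at h2
  simp only [clearedMatrix, rowWeight, Matrix.of_apply, Function.comp_apply,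
    Fin.prod_univ_succAbove (fun b => hh η (u l) (v b)) j,
    Fin.prod_univ_succAbove (fun b => hh η (v b) (u l)) j]
  linear_combination (z * ∏ b, hh η (u l) (v (j.succAbove b))) * h1 +
    ((∏ b, hh η (v (j.succAbove b)) (u l)) * ∏ a, hh η (u l) (u a) / hh η (u a) (u l)) * h2

theorem clearedMatrix_apply_succAbove (η z : ℂ) {n : ℕ} (v u : Fin (n + 1) → ℂ)
    (j l : Fin (n + 1)) (i : Fin n) :
    clearedMatrix η z v u (j.succAbove i) l =
      clearedRow η z (v ∘ j.succAbove) u (v j) i l := by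
  simp only [clearedMatrix, clearedRow, Matrix.of_apply, Function.comp_apply,
    Fin.prod_univ_succAbove (fun b => hh η (u l) (v b)) j,
    Fin.prod_univ_succAbove (fun b => hh η (v b) (u l)) j]
  ring

theorem clearedRow_self {η : ℂ} (hη : η ≠ 0) (z : ℂ) {n m : ℕ} (x : Fin n → ℂ) (u : Fin m → ℂ)
    (i : Fin n) (l : Fin m) (h : u l - x i ≠ -η) (h' : x i - u l ≠ -η) :
    clearedRow η z x u (x i) i l = rowWeight η z x u l * gg η (u l) (x i) := by
  have h1 := tt_mul_hh hη h
  have h2 := tt_mul_hh hη h'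
  rw [gg_antisymm] at h2
  simp only [clearedRow, rowWeight]
  linear_combination (z * ∏ b, hh η (u l) (x b)) * h1 +
    ((∏ b, hh η (x b) (u l)) * ∏ a, hh η (u l) (u a) / hh η (u a) (u l)) * h2

theorem clearedRow_succAbove {η : ℂ} (hη : η ≠ 0) (z : ℂ) {n : ℕ} (x : Fin n → ℂ)
    (u : Fin (n + 1) → ℂ) (k : Fin (n + 1)) (i l : Fin n)
    (h : u k - u (k.succAbove l) ≠ -η) :
    clearedRow η z x u (u k) i (k.succAbove l) =
      hh η (u (k.succAbove l)) (u k) * clearedMatrix η z x (u ∘ k.succAbove) i l := by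
  have h1 := hh_ne_zero hη h
  simp only [clearedMatrix, clearedRow, Matrix.of_apply, Function.comp_apply,
    Fin.prod_univ_succAbove (fun a => hh η (u (k.succAbove l)) (u a) /
      hh η (u a) (u (k.succAbove l))) k]
  field_simp

theorem exists_polynomial_det_clearedRow (η z : ℂ) {n m : ℕ} (x : Fin n → ℂ) (u : Fin m → ℂ)
    (p : Fin n → Fin m) :
    ∃ Q : Polynomial ℂ, Q.natDegree ≤ n ∧
      ∀ s, Q.eval s = (Matrix.of fun i l => clearedRow η z x u s i (p l)).det := by
  let a : Fin n → Fin n → ℂ := fun i l =>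
    z * tt η (u (p l)) (x i) * ∏ b, hh η (u (p l)) (x b)
  let b : Fin n → Fin n → ℂ := fun i l => tt η (x i) (u (p l)) * (∏ b, hh η (x b) (u (p l))) *
    ∏ a, hh η (u (p l)) (u a) / hh η (u a) (u (p l))
  let A : Matrix (Fin n) (Fin n) ℂ := Matrix.of fun i l => (b i l - a i l) / η
  let B : Matrix (Fin n) (Fin n) ℂ := Matrix.of fun i l =>
    a i l * ((u (p l) + η) / η) + b i l * ((η - u (p l)) / η)
  refine ⟨_, (Polynomial.natDegree_det_X_add_C_le A B).trans_eq (Fintype.card_fin n), ?_⟩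
  intro s
  rw [← Polynomial.coe_evalRingHom, RingHom.map_det]
  congr 1
  ext i l
  simp [A, B, a, b, clearedRow, hh]
  ring

theorem sum_rowWeight_mul_det_clearedRow (η z : ℂ) {n : ℕ} (x : Fin n → ℂ)
    (u : Fin (n + 1) → ℂ) (s : ℂ) (j : Fin (n + 1)) (M : Matrix (Fin (n + 1)) (Fin (n + 1)) ℂ)
    (hj : ∀ l, M j l = rowWeight η z x u l * gg η (u l) s)
    (hM : ∀ i l, M (j.succAbove i) l = clearedRow η z x u s i l) :
    M.det = ∑ k : Fin (n + 1), (-1) ^ (j + k : ℕ) * η * rowWeight η z x u k *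
      (Matrix.of fun i l => clearedRow η z x u s i (k.succAbove l)).det / (u k - s) := by
  rw [Matrix.det_succ_row M j]
  refine Finset.sum_congr rfl fun k _ => ?_
  have : M.submatrix j.succAbove k.succAbove =
      Matrix.of fun i l => clearedRow η z x u s i (k.succAbove l) := by
    ext i l
    simp [hM]
  rw [this, hj, gg]
  ring

theorem det_clearedMatrix_expansion {η : ℂ} (hη : η ≠ 0) (z : ℂ) {n : ℕ}
    {v u : Fin (n + 1) → ℂ} (h : GenericPair η v u) (j : Fin (n + 1)) :
    (clearedMatrix η z v u).det =
      (∏ i, (v j - v (j.succAbove i))) * ∑ k : Fin (n + 1),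
        (-1) ^ (j + k : ℕ) * η * rowWeight η z (v ∘ j.succAbove) u k *
          ((∏ l, hh η (u (k.succAbove l)) (u k)) *
            (clearedMatrix η z (v ∘ j.succAbove) (u ∘ k.succAbove)).det) /
          ((u k - v j) * ∏ i, (u k - v (j.succAbove i))) := by
  set x := v ∘ j.succAbove with hx
  choose Q hQdeg hQ using fun k : Fin (n + 1) =>
    exists_polynomial_det_clearedRow η z x u k.succAbove
  have hexp := sum_rowWeight_mul_det_clearedRow η z x u (v j) j (clearedMatrix η z v u)
    (clearedMatrix_apply_self hη z h j) (fun i l => clearedMatrix_apply_succAbove η z v u j l i)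
  let P : Fin (n + 1) → Polynomial ℂ := fun k =>
    Polynomial.C ((-1) ^ (j + k : ℕ) * η * rowWeight η z x u k) * Q k
  have hP : ∀ k s, (P k).eval s = (-1) ^ (j + k : ℕ) * η * rowWeight η z x u k *
      (Matrix.of fun i l => clearedRow η z x u s i (k.succAbove l)).det := by
    intro k s
    simp only [P, Polynomial.eval_mul, Polynomial.eval_C, hQ]
  have hzero : ∀ i, ∑ k, (P k).eval (x i) / (u k - x i) = 0 := by
    intro i
    simp only [hP]
    let M : Matrix (Fin (n + 1)) (Fin (n + 1)) ℂ := Matrix.of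
      (j.insertNth (fun l => rowWeight η z x u l * gg η (u l) (x i))
        (fun i' l => clearedRow η z x u (x i) i' l))
    rw [← sum_rowWeight_mul_det_clearedRow η z x u (x i) j M (by simp [M]) (by simp [M])]
    refine Matrix.det_zero_of_row_eq (Fin.succAbove_ne j i).symm ?_
    ext l
    simp only [M, Matrix.of_apply, Fin.insertNth_apply_same, Fin.insertNth_apply_succAbove]
    exact (clearedRow_self hη z x u i l (h.shiftUV _ _) (h.shiftVU _ _)).symm
  have hmain := sum_eval_div_sub_eq x (h.injV.comp Fin.succAbove_right_injective) u (v j)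
    (fun k => h.ne j k) (fun i => h.injV.ne (Fin.succAbove_ne j i).symm) (fun k i => h.ne _ k) P
    (fun k => (Polynomial.natDegree_C_mul_le _ _).trans (hQdeg k)) hzero
  simp only [hP] at hmain
  rw [hexp, hmain]
  congr 1
  refine Finset.sum_congr rfl fun k _ => ?_
  rw [← Matrix.det_mul_row]
  congr 3
  congr 1
  ext i l
  exact clearedRow_succAbove hη z x u k i l (h.shiftU _ _ (Fin.succAbove_ne k l).symm)

theorem twistedFJ_row_expansion {η : ℂ} (hη : η ≠ 0) (z : ℂ) {n : ℕ}
    {v u : Fin (n + 1) → ℂ} (h : GenericPair η v u) (j : Fin (n + 1)) :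
    twistedFJ η z (n + 1) v u = ∑ k, gg η (u k) (v j) *
      residueCoeff η z (u k) (v ∘ j.succAbove) (u ∘ k.succAbove) *
        twistedFJ η z n (v ∘ j.succAbove) (u ∘ k.succAbove) := by
  rw [twistedFJ_eq_det_clearedMatrix hη z h, det_clearedMatrix_expansion hη z h j,
    Finset.mul_sum, Finset.mul_sum]
  refine Finset.sum_congr rfl fun k _ => ?_
  rw [twistedFJ_eq_det_clearedMatrix hη z (h.removeNth j k), Delta'_eq_mul_succAbove η v j,
    Delta_eq_mul_succAbove η u k]
  have hsign : ((-1 : ℂ)) ^ (j : ℕ) * (-1) ^ (k : ℕ) * (-1) ^ (j + k : ℕ) = 1 := by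
    rw [← pow_add, ← pow_add, ← two_mul, pow_mul]
    simp
  have hcoeff : (∏ i, gg η (v j) (v (j.succAbove i))) * (∏ i, gg η (u (k.succAbove i)) (u k)) *
      (∏ i, (v j - v (j.succAbove i))) * rowWeight η z (v ∘ j.succAbove) u k *
      (∏ l, hh η (u (k.succAbove l)) (u k)) * (∏ i, (u k - v (j.succAbove i)))⁻¹ =
      residueCoeff η z (u k) (v ∘ j.succAbove) (u ∘ k.succAbove) := by
    rw [residueCoeff, rowWeight, Fin.prod_univ_succAbove (fun a => hh η (u k) (u a) /
      hh η (u a) (u k)) k, div_self (by simp [hh, hη]), one_mul, mul_sub, sub_mul, sub_mul,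
      ← Finset.prod_inv_distrib]
    have e1 : ∀ i, v j - v (j.succAbove i) ≠ 0 := fun i =>
      sub_ne_zero.2 (h.injV.ne (Fin.succAbove_ne j i).symm)
    have e2 : ∀ i, u k - v (j.succAbove i) ≠ 0 := fun i => sub_ne_zero.2 (h.ne _ k)
    have e3 : ∀ i, u (k.succAbove i) - u k ≠ 0 := fun i =>
      sub_ne_zero.2 (h.injU.ne (Fin.succAbove_ne k i))
    have e4 : ∀ i, u (k.succAbove i) - u k + η ≠ 0 := fun i h0 =>
      h.shiftU _ _ (Fin.succAbove_ne k i) (eq_neg_of_add_eq_zero_left h0)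
    congr 1
    · rw [mul_left_comm _ z, mul_assoc z, mul_assoc z]
      simp only [← Finset.prod_mul_distrib]
      congr 1
      refine Finset.prod_congr rfl fun i _ => ?_
      have := e1 i; have := e2 i; have := e3 i
      simp only [gg, hh, ff, Function.comp_apply]
      field_simp
    · simp only [← Finset.prod_mul_distrib]
      refine Finset.prod_congr rfl fun i _ => ?_
      have := e1 i; have := e2 i; have := e3 i; have := e4 i
      simp only [gg, hh, ff, Function.comp_apply]
      rw [show v (j.succAbove i) - u k = -(u k - v (j.succAbove i)) by ring,
        show u k - u (k.succAbove i) = -(u (k.succAbove i) - u k) by ring]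
      field_simp
  rw [← hcoeff, gg]
  simp only [div_eq_mul_inv, mul_inv]
  linear_combination ((∏ i, gg η (v j) (v (j.succAbove i))) *
    (∏ i, gg η (u (k.succAbove i)) (u k)) *
      (∏ i, (v j - v (j.succAbove i))) * rowWeight η z (v ∘ j.succAbove) u k *
      (∏ l, hh η (u (k.succAbove l)) (u k)) * (∏ i, (u k - v (j.succAbove i)))⁻¹ * η *
      (u k - v j)⁻¹ * Delta' η (v ∘ j.succAbove) * Delta η (u ∘ k.succAbove) *
      (clearedMatrix η z (v ∘ j.succAbove) (u ∘ k.succAbove)).det) * hsign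

theorem twistedFJ_column_expansion {η : ℂ} (hη : η ≠ 0) {z : ℂ} (hz : z ≠ 0) {n : ℕ}
    {v u : Fin (n + 1) → ℂ} (h : GenericPair η v u) (k : Fin (n + 1)) :
    z ^ (n + 1) * twistedFJ η z⁻¹ (n + 1) u v = ∑ j, gg η (u k) (v j) *
      residueCoeff η z (v j) (v ∘ j.succAbove) (u ∘ k.succAbove) *
        (z ^ n * twistedFJ η z⁻¹ n (u ∘ k.succAbove) (v ∘ j.succAbove)) := by
  rw [twistedFJ_row_expansion hη z⁻¹ h.swap k, Finset.mul_sum]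
  refine Finset.sum_congr rfl fun j _ => ?_
  rw [gg_antisymm η (v j) (u k), residueCoeff, residueCoeff]
  field_simp
  ring

theorem prod_mul_prod_partial_fractions {m : ℕ} (ε s : ℂ) (v u : Fin (m + 1) → ℂ)
    (hv : Function.Injective v) (hu : Function.Injective u) (huv : ∀ j k, u k ≠ v j)
    (hsv : ∀ j, s ≠ v j) (hsu : ∀ k, s ≠ u k) :
    (∏ i, (s - v i + ε) / (s - v i)) * ∏ i, (s - u i - ε) / (s - u i) =
      1 + ((∑ j, ε / (s - v j) *
          ((∏ i, (v j - v (j.succAbove i) + ε) / (v j - v (j.succAbove i))) *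
            ∏ i, (v j - u i - ε) / (v j - u i))) +
        ∑ k, -ε / (s - u k) *
          ((∏ i, (u k - v i + ε) / (u k - v i)) *
            ∏ i, (u k - u (k.succAbove i) - ε) / (u k - u (k.succAbove i)))) := by
  have hinj : Function.Injective (Sum.elim v u) :=
    hv.sumElim hu fun j k => (huv j k).symm
  have h := prod_shift_div_eq_one_add_sum (Sum.elim v u)
    (Sum.elim (fun _ => ε) (fun _ => -ε)) Finset.univ hinj.injOn s
    (by rintro (i | i) _ <;> simp [hsv, hsu])
  simp only [prod_erase_eq_prod_ite, Fintype.prod_sum_type, Fintype.sum_sum_type,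
    Sum.elim_inl, Sum.elim_inr, Sum.inl.injEq, Sum.inr.injEq, reduceCtorEq, if_false] at h
  simp only [← sub_eq_add_neg] at h
  rw [h]
  congr 2
  · refine Finset.sum_congr rfl fun j _ => ?_
    rw [Fin.prod_univ_succAbove _ j]
    simp [Fin.succAbove_ne]
  · refine Finset.sum_congr rfl fun k _ => ?_
    rw [Fin.prod_univ_succAbove (fun i => if i = k then (1 : ℂ) else _) k]
    simp [Fin.succAbove_ne]

theorem ff_eq_sub_div (η a s : ℂ) : ff η a s = (s - a - η) / (s - a) := by
  rw [ff, ← neg_div_neg_eq]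
  congr 1 <;> ring

theorem residueCoeff_partial_fractions {m : ℕ} (η z s : ℂ) (v u : Fin (m + 1) → ℂ)
    (hv : Function.Injective v) (hu : Function.Injective u) (huv : ∀ j k, u k ≠ v j)
    (hsv : ∀ j, s ≠ v j) (hsu : ∀ k, s ≠ u k) :
    residueCoeff η z s v u = z - 1 +
      ∑ j, η / (s - v j) * (z * ((∏ i, ff η (v j) (v (j.succAbove i))) * ∏ i, ff η (u i) (v j)) +
        (∏ i, ff η (v (j.succAbove i)) (v j)) * ∏ i, ff η (v j) (u i)) -
      ∑ k, η / (s - u k) * (z * ((∏ i, ff η (u k) (v i)) * ∏ i, ff η (u (k.succAbove i)) (u k)) +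
        (∏ i, ff η (v i) (u k)) * ∏ i, ff η (u k) (u (k.succAbove i))) := by
  have h1 := prod_mul_prod_partial_fractions η s v u hv hu huv hsv hsu
  have h2 := prod_mul_prod_partial_fractions (-η) s v u hv hu huv hsv hsu
  simp only [← sub_eq_add_neg, sub_neg_eq_add, ← ff_eq_sub_div, neg_neg] at h1 h2
  have hff : ∀ a b : ℂ, (a - b + η) / (a - b) = ff η a b := fun _ _ => rfl
  simp only [hff] at h1 h2
  rw [residueCoeff, h1, h2]
  simp only [mul_add, Finset.sum_add_distrib, neg_div, neg_mul, Finset.sum_neg_distrib,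
    mul_left_comm _ z, ← Finset.mul_sum]
  ring

theorem exchange_identity (η s t p q ap bp aq bq : ℂ) (hts : t ≠ s) (hsp : s ≠ p) (hsq : s ≠ q)
    (htp : t ≠ p) (htq : t ≠ q) (hpq : q ≠ p) :
    gg η q s * (aq * (ff η q p * ff η t q) - bq * (ff η p q * ff η q t)) *
        (gg η t p * (ap - bp)) -
      gg η t p * (ap * (ff η p s * ff η q p) - bp * (ff η s p * ff η p q)) *
        (gg η q s * (aq - bq)) =
    gg η t s * (η / (s - p) - η / (t - p)) * (ap * ff η q p + bp * ff η p q) *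
        (gg η q p * (aq - bq)) -
      gg η t s * (η / (s - q) - η / (t - q)) * (aq * ff η q p + bq * ff η p q) *
        (gg η q p * (ap - bp)) := by
  have h1 : t - s ≠ 0 := sub_ne_zero.2 hts
  have h2 : s - p ≠ 0 := sub_ne_zero.2 hsp
  have h3 : s - q ≠ 0 := sub_ne_zero.2 hsq
  have h4 : t - p ≠ 0 := sub_ne_zero.2 htp
  have h5 : t - q ≠ 0 := sub_ne_zero.2 htq
  have h6 : q - p ≠ 0 := sub_ne_zero.2 hpq
  simp only [gg, ff]
  rw [show q - s = -(s - q) by ring, show p - q = -(q - p) by ring,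
    show q - t = -(t - q) by ring, show p - s = -(s - p) by ring]
  field_simp
  ring

/-- The product `f(x,V̄) f(Ū,x)`. -/
def crossProd (η x : ℂ) {n m : ℕ} (V : Fin n → ℂ) (U : Fin m → ℂ) : ℂ :=
  (∏ i, ff η x (V i)) * ∏ i, ff η (U i) x

theorem residueCoeff_eq_crossProd (η z x : ℂ) {n m : ℕ} (V : Fin n → ℂ) (U : Fin m → ℂ) :
    residueCoeff η z x V U = z * crossProd η x V U - crossProd η x U V := by
  rw [residueCoeff, crossProd, crossProd, mul_comm (∏ i, ff η (V i) x)]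

theorem crossProd_succAbove (η x : ℂ) {n m : ℕ} (V : Fin (n + 1) → ℂ) (U : Fin (m + 1) → ℂ)
    (j : Fin (n + 1)) (k : Fin (m + 1)) :
    crossProd η x V U =
      ff η x (V j) * ff η (U k) x * crossProd η x (V ∘ j.succAbove) (U ∘ k.succAbove) := by
  simp only [crossProd, Fin.prod_univ_succAbove (fun i => ff η x (V i)) j,
    Fin.prod_univ_succAbove (fun i => ff η (U i) x) k, Function.comp_apply]
  ring

theorem crossProd_left_succAbove (η x : ℂ) {n m : ℕ} (V : Fin (n + 1) → ℂ) (U : Fin m → ℂ)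
    (j : Fin (n + 1)) :
    crossProd η x V U = ff η x (V j) * crossProd η x (V ∘ j.succAbove) U := by
  simp only [crossProd, Fin.prod_univ_succAbove (fun i => ff η x (V i)) j, Function.comp_apply]
  ring

theorem crossProd_right_succAbove (η x : ℂ) {n m : ℕ} (V : Fin n → ℂ) (U : Fin (m + 1) → ℂ)
    (k : Fin (m + 1)) :
    crossProd η x V U = ff η (U k) x * crossProd η x V (U ∘ k.succAbove) := by
  simp only [crossProd, Fin.prod_univ_succAbove (fun i => ff η (U i) x) k, Function.comp_apply]
  ring

theorem residueCoeff_eq_sum_crossProd {m : ℕ} (η z s : ℂ) (v u : Fin (m + 1) → ℂ)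
    (hv : Function.Injective v) (hu : Function.Injective u) (huv : ∀ j k, u k ≠ v j)
    (hsv : ∀ j, s ≠ v j) (hsu : ∀ k, s ≠ u k) :
    residueCoeff η z s v u = z - 1 +
      ∑ j, η / (s - v j) * (z * crossProd η (v j) (v ∘ j.succAbove) u +
        crossProd η (v j) u (v ∘ j.succAbove)) -
      ∑ k, η / (s - u k) * (z * crossProd η (u k) v (u ∘ k.succAbove) +
        crossProd η (u k) (u ∘ k.succAbove) v) := by
  rw [residueCoeff_partial_fractions η z s v u hv hu huv hsv hsu]
  simp only [crossProd, Function.comp_apply, mul_comm (∏ i, ff η (v _) (u i)),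
    mul_comm (∏ i, ff η (u _) (u _))]

theorem comp_succ_succAbove_comp_succ {m : ℕ} (f : Fin (m + 2) → ℂ) (j : Fin (m + 1)) :
    (f ∘ j.succ.succAbove) ∘ Fin.succ = (f ∘ Fin.succ) ∘ j.succAbove := by
  ext i
  simp

theorem GenericPair.tail {η : ℂ} {n : ℕ} {v u : Fin (n + 1) → ℂ} (h : GenericPair η v u) :
    GenericPair η (v ∘ Fin.succ) (u ∘ Fin.succ) :=
  h.comp (Fin.succ_injective _) (Fin.succ_injective _)

/-- The claimed symmetry at a fixed size. -/
def TwistedSymm (η z : ℂ) (n : ℕ) : Prop :=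
  ∀ v u : Fin n → ℂ, GenericPair η v u → twistedFJ η z n v u = z ^ n * twistedFJ η z⁻¹ n u v

theorem TwistedSymm.column_expansion {η : ℂ} (hη : η ≠ 0) {z : ℂ} (hz : z ≠ 0) {m : ℕ}
    (ih : TwistedSymm η z m) (ih' : TwistedSymm η z (m + 1)) {v u : Fin (m + 1) → ℂ}
    (h : GenericPair η v u) (k : Fin (m + 1)) :
    twistedFJ η z (m + 1) v u = ∑ j, gg η (u k) (v j) *
      residueCoeff η z (v j) (v ∘ j.succAbove) (u ∘ k.succAbove) *
        twistedFJ η z m (v ∘ j.succAbove) (u ∘ k.succAbove) := by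
  rw [ih' _ _ h, twistedFJ_column_expansion hη hz h k]
  exact Finset.sum_congr rfl fun j _ => by rw [← ih _ _ (h.removeNth j k)]

theorem TwistedSymm.double_row_expansion {η : ℂ} (hη : η ≠ 0) {z : ℂ} (hz : z ≠ 0) {m : ℕ}
    (ih : TwistedSymm η z m) (ih' : TwistedSymm η z (m + 1)) {v u : Fin (m + 2) → ℂ}
    (h : GenericPair η v u) {v' u' : Fin (m + 1) → ℂ} (hv' : v' = v ∘ Fin.succ)
    (hu' : u' = u ∘ Fin.succ) :
    twistedFJ η z (m + 2) v u =
      gg η (u 0) (v 0) * residueCoeff η z (u 0) v' u' * twistedFJ η z (m + 1) v' u' +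
      ∑ k, ∑ j, gg η (u' k) (v 0) * residueCoeff η z (u' k) v' (u ∘ k.succ.succAbove) *
        (gg η (u 0) (v' j) * residueCoeff η z (v' j) (v' ∘ j.succAbove) (u' ∘ k.succAbove) *
          twistedFJ η z m (v' ∘ j.succAbove) (u' ∘ k.succAbove)) := by
  subst hv' hu'
  rw [twistedFJ_row_expansion hη z h 0, Fin.sum_univ_succ]
  simp only [Fin.succAbove_zero, Function.comp_apply, ← Finset.mul_sum]
  congr 1
  refine Finset.sum_congr rfl fun k _ => ?_
  have hg : GenericPair η (v ∘ Fin.succ) (u ∘ k.succ.succAbove) := by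
    simpa using h.removeNth 0 k.succ
  rw [ih.column_expansion hη hz ih' hg 0]
  simp only [Fin.succAbove_zero, comp_succ_succAbove_comp_succ, Function.comp_apply,
    Fin.succ_succAbove_zero]

theorem TwistedSymm.double_column_expansion {η : ℂ} (hη : η ≠ 0) {z : ℂ} (hz : z ≠ 0) {m : ℕ}
    (ih' : TwistedSymm η z (m + 1)) {v u : Fin (m + 2) → ℂ}
    (h : GenericPair η v u) {v' u' : Fin (m + 1) → ℂ} (hv' : v' = v ∘ Fin.succ)
    (hu' : u' = u ∘ Fin.succ) :
    z ^ (m + 2) * twistedFJ η z⁻¹ (m + 2) u v =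
      gg η (u 0) (v 0) * residueCoeff η z (v 0) v' u' * twistedFJ η z (m + 1) v' u' +
      ∑ j, ∑ k, gg η (u 0) (v' j) * residueCoeff η z (v' j) (v ∘ j.succ.succAbove) u' *
        (gg η (u' k) (v 0) * residueCoeff η z (u' k) (v' ∘ j.succAbove) (u' ∘ k.succAbove) *
          twistedFJ η z m (v' ∘ j.succAbove) (u' ∘ k.succAbove)) := by
  subst hv' hu'
  rw [twistedFJ_column_expansion hη hz h 0, Fin.sum_univ_succ]
  simp only [Fin.succAbove_zero, Function.comp_apply, ← Finset.mul_sum]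
  rw [← ih' _ _ h.tail]
  congr 1
  refine Finset.sum_congr rfl fun j _ => ?_
  have hg : GenericPair η (v ∘ j.succ.succAbove) (u ∘ Fin.succ) := by
    simpa using h.removeNth j.succ 0
  rw [← ih' _ _ hg, twistedFJ_row_expansion hη z hg 0]
  simp only [Fin.succAbove_zero, comp_succ_succAbove_comp_succ, Function.comp_apply,
    Fin.succ_succAbove_zero]

theorem TwistedSymm.residueCoeff_sub_mul {η : ℂ} (hη : η ≠ 0) {z : ℂ} (hz : z ≠ 0) {m : ℕ}
    (ih : TwistedSymm η z m) (ih' : TwistedSymm η z (m + 1)) {v u : Fin (m + 1) → ℂ}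
    (h : GenericPair η v u) (c s t : ℂ) (hsv : ∀ j, s ≠ v j) (hsu : ∀ k, s ≠ u k)
    (htv : ∀ j, t ≠ v j) (htu : ∀ k, t ≠ u k) :
    c * residueCoeff η z s v u * twistedFJ η z (m + 1) v u -
      c * residueCoeff η z t v u * twistedFJ η z (m + 1) v u =
      ∑ j, ∑ k, (c * (η / (s - v j) - η / (t - v j)) *
          (z * crossProd η (v j) (v ∘ j.succAbove) u +
            crossProd η (v j) u (v ∘ j.succAbove)) *
          (gg η (u k) (v j) * residueCoeff η z (u k) (v ∘ j.succAbove) (u ∘ k.succAbove) *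
            twistedFJ η z m (v ∘ j.succAbove) (u ∘ k.succAbove)) -
        c * (η / (s - u k) - η / (t - u k)) *
          (z * crossProd η (u k) v (u ∘ k.succAbove) +
            crossProd η (u k) (u ∘ k.succAbove) v) *
          (gg η (u k) (v j) * residueCoeff η z (v j) (v ∘ j.succAbove) (u ∘ k.succAbove) *
            twistedFJ η z m (v ∘ j.succAbove) (u ∘ k.succAbove))) := by
  simp only [Finset.sum_sub_distrib]
  rw [Finset.sum_comm (f := fun j k => c * (η / (s - u k) - η / (t - u k)) *
    (z * crossProd η (u k) v (u ∘ k.succAbove) + crossProd η (u k) (u ∘ k.succAbove) v) *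
    (gg η (u k) (v j) * residueCoeff η z (v j) (v ∘ j.succAbove) (u ∘ k.succAbove) *
      twistedFJ η z m (v ∘ j.succAbove) (u ∘ k.succAbove)))]
  simp only [← Finset.mul_sum, ← twistedFJ_row_expansion hη z h,
    ← ih.column_expansion hη hz ih' h]
  rw [residueCoeff_eq_sum_crossProd η z s v u h.injV h.injU h.ne hsv hsu,
    residueCoeff_eq_sum_crossProd η z t v u h.injV h.injU h.ne htv htu]
  rw [← Finset.sum_mul, ← Finset.sum_mul]
  simp only [mul_assoc (_ : ℂ) (_ - _) _, ← Finset.mul_sum, sub_mul, Finset.sum_sub_distrib]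
  ring

theorem TwistedSymm.step {η : ℂ} (hη : η ≠ 0) {z : ℂ} (hz : z ≠ 0) {m : ℕ}
    (ih : TwistedSymm η z m) (ih' : TwistedSymm η z (m + 1)) : TwistedSymm η z (m + 2) := by
  intro v u h
  obtain ⟨v', hv'⟩ : ∃ v' : Fin (m + 1) → ℂ, v' = v ∘ Fin.succ := ⟨_, rfl⟩
  obtain ⟨u', hu'⟩ : ∃ u' : Fin (m + 1) → ℂ, u' = u ∘ Fin.succ := ⟨_, rfl⟩
  have h' : GenericPair η v' u' := hv' ▸ hu' ▸ h.tail
  have hsv : ∀ j, v 0 ≠ v' j := fun j => hv' ▸ h.injV.ne (Fin.succ_ne_zero j).symm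
  have hsu : ∀ k, v 0 ≠ u' k := fun k => hu' ▸ (h.ne 0 k.succ).symm
  have htv : ∀ j, u 0 ≠ v' j := fun j => hv' ▸ h.ne j.succ 0
  have htu : ∀ k, u 0 ≠ u' k := fun k => hu' ▸ h.injU.ne (Fin.succ_ne_zero k).symm
  rw [ih.double_row_expansion hη hz ih' h hv' hu', ih'.double_column_expansion hη hz h hv' hu',
    ← sub_eq_zero, Finset.sum_comm, add_sub_add_comm, ← neg_sub,
    ih.residueCoeff_sub_mul hη hz ih' h' _ _ _ hsv hsu htv htu, neg_add_eq_zero,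
    ← Finset.sum_sub_distrib]
  refine Finset.sum_congr rfl fun j _ => ?_
  rw [← Finset.sum_sub_distrib]
  refine Finset.sum_congr rfl fun k _ => ?_
  have hu0 : ((u ∘ k.succ.succAbove) ∘ (0 : Fin (m + 1)).succAbove) = u' ∘ k.succAbove := by
    rw [Fin.succAbove_zero, comp_succ_succAbove_comp_succ, hu']
  have hv0 : ((v ∘ j.succ.succAbove) ∘ (0 : Fin (m + 1)).succAbove) = v' ∘ j.succAbove := by
    rw [Fin.succAbove_zero, comp_succ_succAbove_comp_succ, hv']
  have hut : (u ∘ k.succ.succAbove) 0 = u 0 := by simp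
  have hvs : (v ∘ j.succ.succAbove) 0 = v 0 := by simp
  simp only [residueCoeff_eq_crossProd]
  rw [crossProd_succAbove η (u' k) v' (u ∘ k.succ.succAbove) j 0,
    crossProd_succAbove η (u' k) (u ∘ k.succ.succAbove) v' 0 j,
    crossProd_succAbove η (v' j) (v ∘ j.succ.succAbove) u' 0 k,
    crossProd_succAbove η (v' j) u' (v ∘ j.succ.succAbove) k 0, hu0, hv0, hut, hvs,
    crossProd_right_succAbove η (v' j) (v' ∘ j.succAbove) u' k,
    crossProd_left_succAbove η (v' j) u' (v' ∘ j.succAbove) k,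
    crossProd_left_succAbove η (u' k) v' (u' ∘ k.succAbove) j,
    crossProd_right_succAbove η (u' k) (u' ∘ k.succAbove) v' j]
  linear_combination twistedFJ η z m (v' ∘ j.succAbove) (u' ∘ k.succAbove) *
    -exchange_identity η (v 0) (u 0) (v' j) (u' k)
      (z * crossProd η (v' j) (v' ∘ j.succAbove) (u' ∘ k.succAbove))
      (crossProd η (v' j) (u' ∘ k.succAbove) (v' ∘ j.succAbove))
      (z * crossProd η (u' k) (v' ∘ j.succAbove) (u' ∘ k.succAbove))
      (crossProd η (u' k) (u' ∘ k.succAbove) (v' ∘ j.succAbove))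
      (h.ne 0 0) (hsv j) (hsu k) (htv j) (htu k) (h'.ne j k)

theorem twistedFJ_zero (η z : ℂ) (v u : Fin 0 → ℂ) : twistedFJ η z 0 v u = 1 := by
  simp [twistedFJ, Delta, Delta']

theorem twistedSymm {η : ℂ} (hη : η ≠ 0) {z : ℂ} (hz : z ≠ 0) (n : ℕ) : TwistedSymm η z n := by
  induction n using Nat.twoStepInduction with
  | zero =>
    intro v u _
    simp [twistedFJ_zero]
  | one =>
    intro v u h
    rw [twistedFJ_row_expansion hη z h 0, twistedFJ_column_expansion hη hz h 0]
    simp [twistedFJ_zero, residueCoeff]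
  | more m ih ih' => exact ih.step hη hz ih'

/-- the symmetry relation `𝔽_N(v̄,ū|β) = e^{βN} 𝔽_N(ū,v̄|−β)`. -/
theorem stmt8 (η β : ℂ) (hη : η ≠ 0) (N : ℕ) (hN : 1 ≤ N) (v u : Fin N → ℂ)
    (hu : Function.Injective u) (hv : Function.Injective v)
    (huv : ∀ j k, u k ≠ v j)
    (huη : ∀ a b, a ≠ b → u a - u b ≠ η ∧ u a - u b ≠ -η)
    (hvη : ∀ a b, a ≠ b → v a - v b ≠ η ∧ v a - v b ≠ -η)
    (huvη : ∀ j k, u k - v j ≠ η ∧ u k - v j ≠ -η) :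
    FJ η β N v u = Complex.exp β ^ N * FJ η (-β) N u v := by
  have h : GenericPair η v u :=
    ⟨hu, hv, huv, fun a b hab => (huη a b hab).2, fun a b hab => (hvη a b hab).2,
      fun j k => (huvη j k).2,
      fun j k hjk => (huvη j k).1 (by linear_combination -hjk)⟩
  have hsymm := twistedSymm hη (Complex.exp_ne_zero β) N v u h
  rw [← Complex.exp_neg] at hsymm
  exact hsymm
end
end
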